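/- Fix s-stage RK coefficients a_{ij}, b_i, c_i with b_i ≠ 0 for all i, step sizes h_n ≠ 0 and times t_n (n = 0,…,N−1), a differentiable cost C : ℝ^d → ℝ, and f : ℝ^d × ℝ^ν × ℝ → ℝ^d differentiable in its first two arguments. For fixed multipliers λ₀,…,λ_N ∈ ℝ^d and Λ_{n,i} ∈ ℝ^d, define the Lagrangian L(α, x₀,…,x_N, (k_{n,i}), (U_{n,i})) = C(x_N) − λ₀ᵀ(x₀ − α) − Σ_{n=0}^{N−1} λ_{n+1}ᵀ( x_{n+1} − x_n − h_n Σ_{i=1}^s b_i k_{n,i} ) − Σ_{n=0}^{N−1} h_n Σ_{i=1}^s b_i Λ_{n,i}ᵀ( k_{n,i} − f(X_{n,i}, U_{n,i}, t_n + c_i h_n) ), where X_{n,i} = x_n + h_n Σ_{j=1}^s a_{ij} k_{n,j}. Suppose at a given point the partial gradients of L with respect to x₀,…,x_N, every k_{n,i} and every U_{n,i} all vanish. Then: (i) λ_N = ∇C(x_N); (ii) setting ℓ_{n,i} = −(∂_x f(X_{n,i}, U_{n,i}, t_n + c_i h_n))ᵀ Λ_{n,i}, one has λ_{n+1} = λ_n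 + h_n Σ_{i=1}^s B_i ℓ_{n,i} and Λ_{n,i} = λ_n + h_n Σ_{j=1}^s A_{ij} ℓ_{n,j}, where A_{ij} = b_j − b_j a_{ji}/b_i and B_i = b_i; and (iii) (∂_u f(X_{n,i}, U_{n,i}, t_n + c_i h_n))ᵀ Λ_{n,i} = 0 for all n and i. -/

import Mathlib

open Matrix BigOperators

/-- Theorem 4.4 (Hager's result, direct approach): the first-order necessary
conditions for minimising `C(x_N)` subject to the RK constraints, obtained via the
Lagrangian, coincide with a symplectic PRK discretisation of the costate equations
`dλ/dt = −∂_x f ᵀ λ` (with coefficients `A_{ij} = b_j − b_j a_{ji}/b_i`, `B_i = b_i`)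
together with the constraints `∂_u f ᵀ Λ = 0` and `λ_N = ∇C(x_N)`. -/
theorem stmt_15 (d ν s N : ℕ)
    (a : Fin s → Fin s → ℝ) (b c : Fin s → ℝ) (hb : ∀ i, b i ≠ 0)
    (h : Fin N → ℝ) (hh : ∀ n, h n ≠ 0) (t : Fin N → ℝ)
    (C : (Fin d → ℝ) → ℝ) (hC : Differentiable ℝ C)
    (f : (Fin d → ℝ) → (Fin ν → ℝ) → ℝ → (Fin d → ℝ))
    (Df : (Fin d → ℝ) → (Fin ν → ℝ) → ℝ →
      (((Fin d → ℝ) × (Fin ν → ℝ)) →L[ℝ] (Fin d → ℝ)))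
    (Jx : (Fin d → ℝ) → (Fin ν → ℝ) → ℝ → Matrix (Fin d) (Fin d) ℝ)
    (Ju : (Fin d → ℝ) → (Fin ν → ℝ) → ℝ → Matrix (Fin d) (Fin ν) ℝ)
    (hf : ∀ y u τ, HasFDerivAt
      (fun p : (Fin d → ℝ) × (Fin ν → ℝ) => f p.1 p.2 τ) (Df y u τ) (y, u))
    (hDf : ∀ y u τ v w, Df y u τ (v, w) = (Jx y u τ).mulVec v + (Ju y u τ).mulVec w)
    -- the multipliers
    (lam : Fin (N + 1) → Fin d → ℝ) (Lam : Fin N → Fin s → Fin d → ℝ)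
    -- the Lagrangian
    (L : (Fin d → ℝ) → (Fin (N + 1) → Fin d → ℝ) → (Fin N → Fin s → Fin d → ℝ) →
      (Fin N → Fin s → Fin ν → ℝ) → ℝ)
    (X : Fin N → Fin s → Fin d → ℝ)
    -- the point at which the gradients are evaluated
    (α : Fin d → ℝ) (x : Fin (N + 1) → Fin d → ℝ)
    (k : Fin N → Fin s → Fin d → ℝ) (Uc : Fin N → Fin s → Fin ν → ℝ)
    (hX : ∀ (n : Fin N) (i : Fin s),
      X n i = x n.castSucc + h n • ∑ j, a i j • k n j)
    (hL : ∀ (α' : Fin d → ℝ) (x' : Fin (N + 1) → Fin d → ℝ)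
        (k' : Fin N → Fin s → Fin d → ℝ) (U' : Fin N → Fin s → Fin ν → ℝ),
      L α' x' k' U' =
        C (x' (Fin.last N)) - lam 0 ⬝ᵥ (x' 0 - α')
          - ∑ n : Fin N, lam n.succ ⬝ᵥ
              (x' n.succ - x' n.castSucc - h n • ∑ i, b i • k' n i)
          - ∑ n : Fin N, h n * ∑ i, b i *
              (Lam n i ⬝ᵥ (k' n i -
                f (x' n.castSucc + h n • ∑ j, a i j • k' n j) (U' n i)
                  (t n + c i * h n))))
    -- the gradient of the cost at the final state
    (gC : Fin d → ℝ) (hgC : ∀ v, fderiv ℝ C (x (Fin.last N)) v = gC ⬝ᵥ v)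
    -- hypothesis: all partial gradients of L with respect to the x_m, the k_{n,i}
    -- and the U_{n,i} vanish
    (hgradx : ∀ m : Fin (N + 1),
      fderiv ℝ (fun v => L α (Function.update x m v) k Uc) (x m) = 0)
    (hgradk : ∀ (n : Fin N) (i : Fin s),
      fderiv ℝ (fun v => L α x (Function.update k n (Function.update (k n) i v)) Uc)
        (k n i) = 0)
    (hgradU : ∀ (n : Fin N) (i : Fin s),
      fderiv ℝ (fun v => L α x k (Function.update Uc n (Function.update (Uc n) i v)))
        (Uc n i) = 0) :
    -- (i) λ_N = ∇C(x_N)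
    lam (Fin.last N) = gC ∧
    -- (ii) the multipliers perform a PRK integration of the costate equations with
    --      the companion coefficients A_{ij} = b_j − b_j a_{ji}/b_i, B_i = b_i
    (∀ ell : Fin N → Fin s → Fin d → ℝ,
      (∀ (n : Fin N) (i : Fin s),
        ell n i = -((Jx (X n i) (Uc n i) (t n + c i * h n))ᵀ.mulVec (Lam n i))) →
      (∀ n : Fin N, lam n.succ = lam n.castSucc + h n • ∑ i, b i • ell n i) ∧
      (∀ (n : Fin N) (i : Fin s),
        Lam n i = lam n.castSucc + h n • ∑ j, (b j - b j * a j i / b i) • ell n j)) ∧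
    -- (iii) the discrete optimality constraints ∂_u f ᵀ Λ = 0
    (∀ (n : Fin N) (i : Fin s),
      (Ju (X n i) (Uc n i) (t n + c i * h n))ᵀ.mulVec (Lam n i) = 0) := by
  -- transposes
  have tr : ∀ {p q : ℕ} (M : Matrix (Fin p) (Fin q) ℝ) (u : Fin p → ℝ) (v : Fin q → ℝ),
      u ⬝ᵥ M.mulVec v = Mᵀ.mulVec u ⬝ᵥ v := by
    intro p q M u v
    rw [Matrix.dotProduct_mulVec, Matrix.mulVec_transpose]
  -- differentiability of the Lagrangian
  have hfd : ∀ τ, Differentiable ℝ (fun p : (Fin d → ℝ) × (Fin ν → ℝ) => f p.1 p.2 τ) :=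
    fun τ p => (hf p.1 p.2 τ).differentiableAt
  have dotd : ∀ {E : Type} [NormedAddCommGroup E] [NormedSpace ℝ E] (u : Fin d → ℝ)
      (g : E → Fin d → ℝ), Differentiable ℝ g → Differentiable ℝ (fun e => u ⬝ᵥ g e) := by
    intro E _ _ u g hg
    unfold dotProduct
    fun_prop
  have hLd : Differentiable ℝ (fun p : (Fin (N + 1) → Fin d → ℝ) ×
      (Fin N → Fin s → Fin d → ℝ) × (Fin N → Fin s → Fin ν → ℝ) => L α p.1 p.2.1 p.2.2) := by
    simp only [hL]
    refine Differentiable.sub (Differentiable.sub (Differentiable.sub ?_ ?_) ?_) ?_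
    · exact hC.comp (by fun_prop)
    · exact dotd _ _ (by fun_prop)
    · refine Differentiable.fun_sum fun n _ => dotd _ _ (by fun_prop)
    · refine Differentiable.fun_sum fun n _ => Differentiable.const_mul
        (Differentiable.fun_sum fun i _ => Differentiable.const_mul (dotd _ _ ?_) _) _
      refine Differentiable.sub (by fun_prop) ?_
      exact (hfd (t n + c i * h n)).comp (f := fun p : (Fin (N + 1) → Fin d → ℝ) ×
        (Fin N → Fin s → Fin d → ℝ) × (Fin N → Fin s → Fin ν → ℝ) =>
        (p.1 n.castSucc + h n • ∑ j, a i j • p.2.1 n j, p.2.2 n i)) (by fun_prop)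
  -- directional derivative
  have dotD : ∀ (u : Fin d → ℝ) (g : ℝ → Fin d → ℝ) (g' : Fin d → ℝ), HasDerivAt g g' 0 →
      HasDerivAt (fun e => u ⬝ᵥ g e) (u ⬝ᵥ g') 0 := by
    intro u g g' hg
    unfold dotProduct
    exact HasDerivAt.fun_sum fun i _ => ((hasDerivAt_pi.1 hg) i).const_mul _
  have lin : ∀ {p : ℕ} (y v : Fin p → ℝ), HasDerivAt (fun e : ℝ => y + e • v) v 0 := by
    intro p y v
    simpa using ((hasDerivAt_id (0:ℝ)).smul_const v).const_add y
  have key : ∀ (dx : Fin (N + 1) → Fin d → ℝ) (dk : Fin N → Fin s → Fin d → ℝ)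
      (dU : Fin N → Fin s → Fin ν → ℝ),
      HasDerivAt (fun e : ℝ => L α (x + e • dx) (k + e • dk) (Uc + e • dU))
        (gC ⬝ᵥ dx (Fin.last N) - lam 0 ⬝ᵥ dx 0
          - ∑ n : Fin N, lam n.succ ⬝ᵥ
              (dx n.succ - dx n.castSucc - h n • ∑ i, b i • dk n i)
          - ∑ n : Fin N, h n * ∑ i, b i *
              (Lam n i ⬝ᵥ (dk n i -
                ((Jx (X n i) (Uc n i) (t n + c i * h n)).mulVec
                    (dx n.castSucc + h n • ∑ j, a i j • dk n j)
                  + (Ju (X n i) (Uc n i) (t n + c i * h n)).mulVec (dU n i))))) 0 := by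
    intro dx dk dU
    simp only [hL, Pi.add_apply, Pi.smul_apply]
    have hk : ∀ n i, HasDerivAt (fun e : ℝ => k n i + e • dk n i) (dk n i) 0 :=
      fun n i => lin _ _
    have hx : ∀ n, HasDerivAt (fun e : ℝ => x n + e • dx n) (dx n) 0 :=
      fun n => lin _ _
    refine HasDerivAt.sub (HasDerivAt.sub (HasDerivAt.sub ?_ ?_) ?_) ?_
    · rw [← hgC]
      refine HasFDerivAt.comp_hasDerivAt (f := fun e : ℝ => x (Fin.last N) + e • dx (Fin.last N))
        (0:ℝ) ?_ (hx _)
      simpa using (hC (x (Fin.last N))).hasFDerivAt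
    · exact dotD _ _ _ ((hx 0).sub_const _)
    · refine HasDerivAt.fun_sum fun n _ => dotD _ _ _ ?_
      exact ((hx _).sub (hx _)).sub
        ((HasDerivAt.fun_sum fun i _ => (hk n i).const_smul (b i)).const_smul (h n))
    · refine HasDerivAt.fun_sum fun n _ => HasDerivAt.const_mul _
        (HasDerivAt.fun_sum fun i _ => HasDerivAt.const_mul _ (dotD _ _ _ ?_))
      refine (hk n i).sub ?_
      rw [← hDf]
      have h1 := ((hx n.castSucc).add
        ((HasDerivAt.fun_sum fun j (_ : j ∈ Finset.univ) =>
          (hk n j).const_smul (a i j)).const_smul (h n))).prodMk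
        (lin (Uc n i) (dU n i))
      refine HasFDerivAt.comp_hasDerivAt (l := fun p : (Fin d → ℝ) × (Fin ν → ℝ) =>
        f p.1 p.2 (t n + c i * h n)) (0:ℝ) ?_ h1
      have h2 := hf (X n i) (Uc n i) (t n + c i * h n)
      rw [hX] at h2 ⊢
      simpa using h2
  -- chain rule for vanishing partial gradients
  have van : ∀ {p : ℕ} (g : (Fin p → ℝ) → ℝ) (y v : Fin p → ℝ), Differentiable ℝ g →
      fderiv ℝ g y = 0 → HasDerivAt (fun e : ℝ => g (y + e • v)) 0 0 := by
    intro p g y v hg h0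
    have h1 : HasFDerivAt g (0 : (Fin p → ℝ) →L[ℝ] ℝ) (y + (0:ℝ) • v) := by
      rw [← h0]; simpa using (hg y).hasFDerivAt
    exact h1.comp_hasDerivAt (0:ℝ) (lin y v)
  have upd1 : ∀ {p q : ℕ} (z : Fin p → Fin q → ℝ) (m : Fin p) (v : Fin q → ℝ) (e : ℝ),
      Function.update z m (z m + e • v) = z + e • (Pi.single m v : Fin p → Fin q → ℝ) := by
    intro p q z m v e
    ext m' r
    by_cases hm : m' = m
    · subst hm; simp
    · simp [hm]
  have upd2 : ∀ {p q r : ℕ} (z : Fin p → Fin q → Fin r → ℝ) (n : Fin p) (i : Fin q)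
      (v : Fin r → ℝ) (e : ℝ),
      Function.update z n (Function.update (z n) i (z n i + e • v))
        = z + e • (Pi.single n (Pi.single i v) : Fin p → Fin q → Fin r → ℝ) := by
    intro p q r z n i v e
    ext m' j r'
    rw [upd1]
    by_cases hm : m' = n
    · subst hm; simp
    · simp [hm]
  have dupd : ∀ {p q : ℕ} (z : Fin p → Fin q → ℝ) (m : Fin p),
      Differentiable ℝ (fun v => Function.update z m v) :=
    fun z m v => (hasFDerivAt_update z v).differentiableAt
  have dupd2 : ∀ {p q r : ℕ} (z : Fin p → Fin q → Fin r → ℝ) (n : Fin p) (i : Fin q),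
      Differentiable ℝ (fun v => Function.update z n (Function.update (z n) i v)) := by
    intro p q r z n i
    exact Differentiable.comp (g := fun w => Function.update z n w)
      (fun w => (hasFDerivAt_update z w).differentiableAt) (dupd (z n) i)
  have Ex : ∀ m v, _ = (0:ℝ) := fun m v => (key (Pi.single m v) 0 0).unique (by
    have := van _ _ v (hLd.comp ((dupd x m).prodMk
      (differentiable_const (c := (k, Uc))))) (hgradx m)
    simpa [Function.comp_def, upd1] using this)
  have Ek : ∀ n i v, _ = (0:ℝ) := fun n i v =>
    (key 0 (Pi.single n (Pi.single i v)) 0).unique (by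
    have := van _ _ v (hLd.comp ((differentiable_const (c := x)).prodMk ((dupd2 k n i).prodMk
      (differentiable_const (c := Uc))))) (hgradk n i)
    simpa [Function.comp_def, upd2] using this)
  have EU : ∀ n i v, _ = (0:ℝ) := fun n i v =>
    (key 0 0 (Pi.single n (Pi.single i v))).unique (by
    have := van _ _ v (hLd.comp ((differentiable_const (c := x)).prodMk
      ((differentiable_const (c := k)).prodMk (dupd2 Uc n i)))) (hgradU n i)
    simpa [Function.comp_def, upd2] using this)
  clear key hgradx hgradk hgradU hLd
  have S1 : ∀ {p : ℕ} (m m' : Fin p) (v : Fin d → ℝ),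
    (Pi.single m v : Fin p → Fin d → ℝ) m' = (if m' = m then (1:ℝ) else 0) • v := by
    intro p m m' v
    by_cases hm : m' = m
    · subst hm; simp
    · simp [hm]
  have S2 : ∀ {p q r : ℕ} (n m : Fin p) (i j : Fin q) (v : Fin r → ℝ),
    (Pi.single n (Pi.single i v) : Fin p → Fin q → Fin r → ℝ) m j
      = (if m = n then (1:ℝ) else 0) • (if j = i then (1:ℝ) else 0) • v := by
    intro p q r n m i j v
    by_cases hm : m = n
    · subst hm
      by_cases hj : j = i
      · subst hj; simp
      · simp [hj]
    · simp [hm]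
  have Ex' : ∀ m v, (if Fin.last N = m then 1 else 0) * (gC ⬝ᵥ v) - lam m ⬝ᵥ v
      + ∑ n : Fin N, (if n.castSucc = m then 1 else 0) * ((lam n.succ
        + h n • ∑ i, b i • (Jx (X n i) (Uc n i) (t n + c i * h n))ᵀ.mulVec (Lam n i)) ⬝ᵥ v)
        = 0 := by
    intro m v
    refine Eq.trans ?_ (Ex m v)
    have e1 : lam m ⬝ᵥ v = lam 0 ⬝ᵥ (Pi.single m v : Fin (N+1) → Fin d → ℝ) 0
        + ∑ n : Fin N, lam n.succ ⬝ᵥ (Pi.single m v : Fin (N+1) → Fin d → ℝ) n.succ := by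
      rw [← Fin.sum_univ_succ
        (f := fun m' => lam m' ⬝ᵥ (Pi.single m v : Fin (N+1) → Fin d → ℝ) m')]
      simp only [S1, dotProduct_smul, smul_eq_mul, ite_mul, one_mul, zero_mul,
        Finset.sum_ite_eq', Finset.mem_univ, if_true]
    rw [e1]
    simp only [S1, Pi.zero_apply, smul_zero, Finset.sum_const_zero, add_zero, sub_zero, zero_sub,
      Matrix.mulVec_zero, dotProduct_sub, dotProduct_neg, tr, dotProduct_smul, smul_eq_mul,
      add_dotProduct, smul_dotProduct, sum_dotProduct, mul_add, Finset.sum_add_distrib,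
      Finset.sum_sub_distrib, mul_neg, Finset.sum_neg_distrib, Finset.mul_sum]
    have e2 : ∀ A B C' D E F : ℝ, E = F →
      A - (B + C') + (D + E) = A - B - (C' - D) - (-F) := by
      intros; subst_vars; ring
    apply e2
    refine Finset.sum_congr rfl fun n _ => Finset.sum_congr rfl fun i _ => ?_
    ring
  refine ⟨?_, ?_, ?_⟩
  · refine (dotProduct_eq _ _ fun v => ?_)
    have := Ex' (Fin.last N) v
    simp [Fin.castSucc_ne_last] at this
    linarith
  · intro ell hell
    have P1 : ∀ n : Fin N, lam n.succ = lam n.castSucc + h n • ∑ i, b i • ell n i := by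
      intro n
      refine (dotProduct_eq _ _ fun v => ?_)
      have := Ex' n.castSucc v
      simp only [hell]
      simp [(Fin.castSucc_ne_last _).symm, Fin.castSucc_inj, add_dotProduct] at this ⊢
      linarith
    refine ⟨P1, fun n i => ?_⟩
    have Q : Lam n i = lam n.succ - h n • ∑ j, (b j * a j i / b i) • ell n j := by
      refine (dotProduct_eq _ _ fun v => ?_)
      have := Ek n i v
      have hn := hh n
      have hbi := hb i
      simp only [S2, Pi.zero_apply, Matrix.mulVec_zero, zero_add, add_zero, sub_zero, zero_sub,
        dotProduct_sub, dotProduct_zero, dotProduct_neg, tr, dotProduct_smul, smul_eq_mul,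
        dotProduct_sum, mul_ite, ite_mul, mul_one, mul_zero, one_mul, zero_mul, mul_sub,
        Finset.sum_sub_distrib, Finset.sum_ite_eq', Finset.mem_univ, if_true,
        Finset.sum_neg_distrib, Finset.sum_ite_irrel, Finset.sum_const_zero] at this
      have e3 : (h n • ∑ j, (b j * a j i / b i) • ell n j) ⬝ᵥ v
          = -((∑ x, b x * (h n * (a x i *
            ((Jx (X n x) (Uc n x) (t n + c x * h n))ᵀ.mulVec (Lam n x) ⬝ᵥ v)))) / b i) := by
        simp only [hell, smul_dotProduct, sum_dotProduct, neg_dotProduct, smul_eq_mul,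
          Finset.sum_div, Finset.mul_sum, ← Finset.sum_neg_distrib]
        refine Finset.sum_congr rfl fun j _ => ?_
        ring
      rw [sub_dotProduct, e3]
      generalize (∑ x, b x * (h n * (a x i *
            ((Jx (X n x) (Uc n x) (t n + c x * h n))ᵀ.mulVec (Lam n x) ⬝ᵥ v)))) = σ at this ⊢
      have this : h n * (b i * lam n.succ ⬝ᵥ v - b i * Lam n i ⬝ᵥ v + σ) = 0 := by linarith
      have this := (mul_eq_zero.1 this).resolve_left hn
      apply mul_left_cancel₀ hbi
      field_simp
      linarith
    rw [Q, P1]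
    simp only [sub_smul, Finset.sum_sub_distrib, smul_sub]
    abel
  · intro n i
    refine (dotProduct_eq _ _ fun v => ?_)
    have := EU n i v
    have hn := hh n
    have hbi := hb i
    simp only [S2, smul_zero, mul_neg, Pi.zero_apply, Matrix.mulVec_zero, zero_add, add_zero, sub_zero, zero_sub,
        dotProduct_sub, dotProduct_zero, dotProduct_neg, tr, dotProduct_smul, smul_eq_mul,
        dotProduct_sum, mul_ite, ite_mul, mul_one, mul_zero, one_mul, zero_mul, mul_sub,
        Finset.sum_sub_distrib, Finset.sum_ite_eq', Finset.mem_univ, if_true,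
        Finset.sum_neg_distrib, Finset.sum_ite_irrel, Finset.sum_const_zero] at this
    simpa [hn, hbi] using this
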